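/- If {k_j}_{j=1}^∞ is an orthonormal basis of H and φ : W → C is a bounded linear map into a real Hilbert space C with operator norm ‖φ‖_{W*⊗C}, then ∑_{j=1}^∞ ‖φ(k_j)‖²_C ≤ C₂ · ‖φ‖²_{W*⊗C}, where C₂ := ∫_W ‖w‖²_W dμ(w). -/

import Mathlib

open MeasureTheory

universe u

/-- The (extended-real-valued) Cameron–Martin norm
`‖w‖_H := sup{|u(w)|/√(q(u,u)) : u ∈ W*, u ≠ 0}`. -/
noncomputable def cmNormE {W : Type*} [NormedAddCommGroup W] [NormedSpace ℝ W]
    (q : (W →L[ℝ] ℝ) →ₗ[ℝ] (W →L[ℝ] ℝ) →ₗ[ℝ] ℝ) (w : W) : ENNReal :=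
  ⨆ u : {u : W →L[ℝ] ℝ // u ≠ 0}, ENNReal.ofReal (|u.1 w| / Real.sqrt (q u.1 u.1))

open ProbabilityTheory

section GaussianCharacteristicFunctional

variable {W : Type*} [NormedAddCommGroup W] [NormedSpace ℝ W] [MeasurableSpace W] [BorelSpace W]
  {μ : Measure W} {q : (W →L[ℝ] ℝ) →ₗ[ℝ] (W →L[ℝ] ℝ) →ₗ[ℝ] ℝ}

/-- If the characteristic functional of `μ` is `exp (-q(u,u)/2)`, then every continuous linear
functional `u` is a centered real Gaussian variable of variance `q(u,u)`. -/
lemma map_eq_gaussianReal_of_integral_cexp_eq [IsFiniteMeasure μ]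
    (hchar : ∀ u : W →L[ℝ] ℝ,
      ∫ x, Complex.exp (Complex.I * (u x : ℂ)) ∂μ = (Real.exp (-q u u / 2) : ℂ))
    {u : W →L[ℝ] ℝ} (hu : 0 ≤ q u u) :
    μ.map u = gaussianReal 0 (q u u).toNNReal := by
  refine Measure.ext_of_charFun ?_
  ext t
  rw [charFun_gaussianReal, charFun_apply_real, integral_map (by fun_prop) (by fun_prop)]
  have h := hchar (t • u)
  simp only [FunLike.coe_smul, Pi.smul_apply, smul_eq_mul, map_smul,
    LinearMap.smul_apply] at h
  calc ∫ x, Complex.exp (t * (u x : ℂ) * Complex.I) ∂μ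
      = ∫ x, Complex.exp (Complex.I * ((t * u x : ℝ) : ℂ)) ∂μ := by
        refine integral_congr_ae (Filter.Eventually.of_forall fun x ↦ ?_)
        push_cast
        ring_nf
    _ = _ := by
        rw [h, Complex.ofReal_exp, Real.coe_toNNReal _ hu]
        push_cast
        ring_nf

/-- The second moment of a continuous linear functional `u` is `q(u,u)`. -/
lemma integral_sq_eq_of_integral_cexp_eq [IsFiniteMeasure μ]
    (hchar : ∀ u : W →L[ℝ] ℝ,
      ∫ x, Complex.exp (Complex.I * (u x : ℂ)) ∂μ = (Real.exp (-q u u / 2) : ℂ))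
    {u : W →L[ℝ] ℝ} (hu : 0 ≤ q u u) :
    ∫ x, u x ^ 2 ∂μ = q u u := by
  have h : ∫ y, y ^ 2 ∂(μ.map u) = ∫ x, u x ^ 2 ∂μ :=
    integral_map (by fun_prop) (by fun_prop)
  rw [← h, map_eq_gaussianReal_of_integral_cexp_eq hchar hu,
    ← variance_of_integral_eq_zero (by fun_prop) integral_id_gaussianReal,
    variance_fun_id_gaussianReal, Real.coe_toNNReal _ hu]

end GaussianCharacteristicFunctional

section CameronMartin

variable {W H : Type*} [NormedAddCommGroup W] [NormedSpace ℝ W]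
  [NormedAddCommGroup H] [InnerProductSpace ℝ H]
  {q : (W →L[ℝ] ℝ) →ₗ[ℝ] (W →L[ℝ] ℝ) →ₗ[ℝ] ℝ}

lemma abs_apply_le_sqrt_mul_of_cmNormE_le {w : W} {r : ℝ} (hr : 0 ≤ r)
    (hw : cmNormE q w ≤ ENNReal.ofReal r) {u : W →L[ℝ] ℝ} (hu : u ≠ 0) (hq : 0 < q u u) :
    |u w| ≤ √(q u u) * r := by
  have h : ENNReal.ofReal (|u w| / √(q u u)) ≤ ENNReal.ofReal r :=
    (le_iSup (fun v : {v : W →L[ℝ] ℝ // v ≠ 0} ↦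
      ENNReal.ofReal (|v.1 w| / √(q v.1 v.1))) ⟨u, hu⟩).trans hw
  rw [ENNReal.ofReal_le_ofReal_iff hr, div_le_iff₀ (Real.sqrt_pos.2 hq)] at h
  linarith

/-- Bessel's inequality for the restriction of a continuous linear functional to the
Cameron–Martin space. -/
lemma sum_sq_apply_le_of_cmNormE_le {ι : H →ₗ[ℝ] W}
    (hnorm : ∀ h : H, cmNormE q (ι h) ≤ ENNReal.ofReal ‖h‖)
    (hpos : ∀ u : W →L[ℝ] ℝ, u ≠ 0 → 0 < q u u)
    {J : Type*} {k : J → H} (hk : Orthonormal ℝ k) (s : Finset J) (u : W →L[ℝ] ℝ) :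
    ∑ j ∈ s, u (ι (k j)) ^ 2 ≤ q u u := by
  rcases eq_or_ne u 0 with rfl | hu
  · simp
  set S := ∑ j ∈ s, u (ι (k j)) ^ 2 with hS
  have hS0 : 0 ≤ S := Finset.sum_nonneg fun _ _ ↦ sq_nonneg _
  set h : H := ∑ j ∈ s, u (ι (k j)) • k j with hh
  have hnh : ‖h‖ ^ 2 = S := by
    rw [← real_inner_self_eq_norm_sq, hh, hk.inner_sum]
    simp [hS, sq]
  have huh : u (ι h) = S := by
    simp [hh, hS, sq]
  have hle := abs_apply_le_sqrt_mul_of_cmNormE_le (norm_nonneg h) (hnorm h) hu (hpos u hu)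
  rw [huh, abs_of_nonneg hS0] at hle
  have hsq : √(q u u) ^ 2 = q u u := Real.sq_sqrt (hpos u hu).le
  nlinarith [sq_nonneg (√(q u u) - ‖h‖)]

end CameronMartin

/-- if `{k_j}` is an orthonormal basis of the Cameron–Martin space `H` of
a Gaussian measure `μ` on a real separable Banach space `W`, and `φ : W → C` is a bounded
linear map into a real Hilbert space `C`, then
`∑_j ‖φ(k_j)‖² ≤ C₂ ‖φ‖²_{W*⊗C}` where `C₂ = ∫ ‖w‖² dμ(w)`. -/
theorem cameronMartin_hs_operator_bound
    {W : Type} [NormedAddCommGroup W] [NormedSpace ℝ W] [CompleteSpace W]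
    [SecondCountableTopology W] [MeasurableSpace W] [BorelSpace W]
    (μ : Measure W) [IsProbabilityMeasure μ]
    (q : (W →L[ℝ] ℝ) →ₗ[ℝ] (W →L[ℝ] ℝ) →ₗ[ℝ] ℝ)
    (hsymm : ∀ u v : W →L[ℝ] ℝ, q u v = q v u)
    (hpos : ∀ u : W →L[ℝ] ℝ, u ≠ 0 → 0 < q u u)
    (hchar : ∀ u : W →L[ℝ] ℝ,
      ∫ x, Complex.exp (Complex.I * (u x : ℂ)) ∂μ
        = (Real.exp (-q u u / 2) : ℂ))
    -- the Cameron–Martin space H, realized as an abstract Hilbert space Hcm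
    -- embedded in W via ι, whose Hilbert norm is the Cameron–Martin norm
    {Hcm : Type} [NormedAddCommGroup Hcm] [InnerProductSpace ℝ Hcm] [CompleteSpace Hcm]
    (ι : Hcm →ₗ[ℝ] W) (hinj : Function.Injective ι)
    (hrange : Set.range ι = {h : W | cmNormE q h ≠ ⊤})
    (hnorm : ∀ h : Hcm, cmNormE q (ι h) = ENNReal.ofReal ‖h‖)
    -- an orthonormal basis {k_j} of H
    (k : HilbertBasis ℕ ℝ Hcm) :
    ∀ (C : Type u) [NormedAddCommGroup C] [InnerProductSpace ℝ C] [CompleteSpace C]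
      (φ : W →L[ℝ] C),
      ∑' j : ℕ, ‖φ (ι (k j))‖ ^ 2 ≤ (∫ w, ‖w‖ ^ 2 ∂μ) * ‖φ‖ ^ 2 := by
  intro C _ _ _ φ
  have hq (u : W →L[ℝ] ℝ) : 0 ≤ q u u := by
    rcases eq_or_ne u 0 with rfl | hu
    · simp
    · exact (hpos u hu).le
  have : IsGaussian μ := isGaussian_of_map_eq_gaussianReal fun L ↦
    ⟨0, _, map_eq_gaussianReal_of_integral_cexp_eq hchar (hq L)⟩
  have hint : Integrable (fun w : W ↦ ‖w‖ ^ 2) μ :=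
    (IsGaussian.memLp_two_id (μ := μ)).integrable_norm_pow (by norm_num)
  have hC₂ : 0 ≤ (∫ w, ‖w‖ ^ 2 ∂μ) * ‖φ‖ ^ 2 := by positivity
  refine tsum_le_of_sum_le' hC₂ fun s ↦ ?_
  classical
  let F : Submodule ℝ C := Submodule.span ℝ ↑(s.image fun j ↦ φ (ι (k j)))
  let e := stdOrthonormalBasis ℝ F
  let u : Fin (Module.finrank ℝ F) → W →L[ℝ] ℝ := fun i ↦ (innerSL ℝ (e i : C)).comp φ
  have he : Orthonormal ℝ fun i ↦ (e i : C) := e.orthonormal.comp_linearIsometry F.subtypeₗᵢ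
  have hparseval : ∀ j ∈ s, ‖φ (ι (k j))‖ ^ 2 = ∑ i, u i (ι (k j)) ^ 2 := by
    intro j hj
    have hmem : φ (ι (k j)) ∈ F :=
      Submodule.subset_span (by simpa using ⟨j, hj, rfl⟩)
    have h := e.sum_sq_norm_inner_right ⟨_, hmem⟩
    simpa [u] using h.symm
  calc ∑ j ∈ s, ‖φ (ι (k j))‖ ^ 2
      = ∑ i, ∑ j ∈ s, u i (ι (k j)) ^ 2 := by
        rw [Finset.sum_congr rfl hparseval, Finset.sum_comm]
    _ ≤ ∑ i, q (u i) (u i) := Finset.sum_le_sum fun i _ ↦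
        sum_sq_apply_le_of_cmNormE_le (fun h ↦ (hnorm h).le) hpos k.orthonormal s (u i)
    _ = ∑ i, ∫ w, u i w ^ 2 ∂μ := Finset.sum_congr rfl fun i _ ↦
        (integral_sq_eq_of_integral_cexp_eq hchar (hq (u i))).symm
    _ = ∫ w, ∑ i, u i w ^ 2 ∂μ := (integral_finsetSum _ fun i _ ↦
        (IsGaussian.memLp_dual μ (u i) 2 (by simp)).integrable_sq).symm
    _ ≤ ∫ w, ‖w‖ ^ 2 * ‖φ‖ ^ 2 ∂μ := by
        refine integral_mono (integrable_finsetSum _ fun i _ ↦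
          (IsGaussian.memLp_dual μ (u i) 2 (by simp)).integrable_sq)
          (hint.mul_const _) fun w ↦ ?_
        have hbessel : ∑ i, u i w ^ 2 ≤ ‖φ w‖ ^ 2 := by
          simpa [u] using he.sum_inner_products_le (φ w) (s := Finset.univ)
        calc ∑ i, u i w ^ 2 ≤ ‖φ w‖ ^ 2 := hbessel
          _ ≤ (‖φ‖ * ‖w‖) ^ 2 := by gcongr; exact φ.le_opNorm w
          _ = ‖w‖ ^ 2 * ‖φ‖ ^ 2 := by ring
    _ = (∫ w, ‖w‖ ^ 2 ∂μ) * ‖φ‖ ^ 2 := integral_mul_const _ _
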